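/- Let n be a positive integer, let w ∈ ℝⁿ have all positive components, and let θ be a positive real number. Let P_{w,θ}ⁿ be the polytope in ℝⁿ determined by the inequalities |xᵢ| ≤ wᵢ for i = 1,…,n and |Σ_{i=1}^n xᵢ| ≤ θ. Then vol_n(P_{w,θ}ⁿ) = (2^{n+1}/π) ∫₀^∞ (sin(θx)/x) ∏_{i=1}^n (sin(wᵢ x)/x) dx. -/

import Mathlib

open MeasureTheory Finset Real

/-- The complex-valued indicator function of the interval `[-a, a]`. -/
noncomputable def symmIndicator (a : ℝ) : ℝ → ℂ := (Set.Icc (-a) a).indicator 1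

lemma symmIndicator_of_abs_le {a x : ℝ} (h : |x| ≤ a) : symmIndicator a x = 1 :=
  Set.indicator_of_mem (Set.mem_Icc.mpr (abs_le.mp h)) _

lemma symmIndicator_of_lt_abs {a x : ℝ} (h : a < |x|) : symmIndicator a x = 0 :=
  Set.indicator_of_notMem (fun hx => h.not_ge (abs_le.mpr (Set.mem_Icc.mp hx))) _

lemma norm_symmIndicator_le_one (a x : ℝ) : ‖symmIndicator a x‖ ≤ 1 := by
  rcases le_or_gt |x| a with h | h
  · simp [symmIndicator_of_abs_le h]
  · simp [symmIndicator_of_lt_abs h]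

lemma measurable_symmIndicator (a : ℝ) : Measurable (symmIndicator a) :=
  measurable_one.indicator measurableSet_Icc

lemma integrable_symmIndicator (a : ℝ) : Integrable (symmIndicator a) :=
  (integrableOn_const (by simp) : IntegrableOn (fun _ => (1 : ℂ)) _ _).integrable_indicator
    measurableSet_Icc

lemma continuousAt_symmIndicator {a x : ℝ} (h : |x| ≠ a) : ContinuousAt (symmIndicator a) x := by
  rcases lt_or_gt_of_ne h with h | h
  · refine (continuousAt_const (y := (1 : ℂ))).congr ?_
    filter_upwards [continuous_abs.continuousAt.eventually (gt_mem_nhds h)] with y hy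
    exact (symmIndicator_of_abs_le (le_of_lt hy)).symm
  · refine (continuousAt_const (y := (0 : ℂ))).congr ?_
    filter_upwards [continuous_abs.continuousAt.eventually (lt_mem_nhds h)] with y hy
    exact (symmIndicator_of_lt_abs hy).symm

lemma integral_exp_mul_symmIndicator {a : ℝ} (ha : 0 < a) (t : ℝ) :
    ∫ u : ℝ, Complex.exp (↑(-2 * π * u * t) * Complex.I) * symmIndicator a u =
      ((2 * a * sinc (2 * π * a * t) : ℝ) : ℂ) := by
  have h1 : (fun u : ℝ => Complex.exp (↑(-2 * π * u * t) * Complex.I) * symmIndicator a u) =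
      (Set.Icc (-a) a).indicator
        (fun u : ℝ => Complex.exp ((-2 * π * t * Complex.I) * u)) := by
    ext u
    by_cases hu : u ∈ Set.Icc (-a) a
    · simp only [symmIndicator, Set.indicator_of_mem hu, Pi.one_apply, mul_one]
      congr 1; push_cast; ring
    · simp [symmIndicator, Set.indicator_of_notMem hu]
  rw [h1, integral_indicator measurableSet_Icc, integral_Icc_eq_integral_Ioc,
    ← intervalIntegral.integral_of_le (by linarith)]
  rcases eq_or_ne t 0 with rfl | ht
  · simp; ring
  · have hc : (-2 * π * t * Complex.I : ℂ) ≠ 0 := by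
      simp [ht, Real.pi_ne_zero]
    rw [integral_exp_mul_complex hc, sinc_of_ne_zero (by simp [ht, ha.ne', Real.pi_ne_zero])]
    have e1 : (-2 * π * t * Complex.I : ℂ) * (a : ℝ) = -(↑(2 * π * a * t) * Complex.I) := by
      push_cast; ring
    have e2 : (-2 * π * t * Complex.I : ℂ) * ((-a : ℝ) : ℂ) = ↑(2 * π * a * t) * Complex.I := by
      push_cast; ring
    rw [e1, e2, Complex.exp_mul_I, ← neg_mul, Complex.exp_mul_I, Complex.cos_neg, Complex.sin_neg]
    have ha' : (a : ℂ) ≠ 0 := by exact_mod_cast ha.ne'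
    have ht' : (t : ℂ) ≠ 0 := by exact_mod_cast ht
    have hp' : (π : ℂ) ≠ 0 := by exact_mod_cast Real.pi_ne_zero
    rw [div_eq_iff hc]
    push_cast
    field_simp
    ring

lemma integrable_sinc_sq : Integrable (fun x => sinc x ^ 2) := by
  refine (integrable_inv_one_add_sq.const_mul 2).mono' (by fun_prop) (ae_of_all _ fun x => ?_)
  have h1 : sinc x ^ 2 ≤ 1 := (sq_le_one_iff_abs_le_one _).mpr (abs_sinc_le_one x)
  have h2 : x ^ 2 * sinc x ^ 2 ≤ 1 := by
    rcases eq_or_ne x 0 with rfl | hx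
    · simp
    · rw [sinc_of_ne_zero hx, div_pow, mul_div_cancel₀ _ (pow_ne_zero 2 hx)]
      exact sin_sq_le_one x
  rw [Real.norm_of_nonneg (sq_nonneg _), ← div_eq_mul_inv, le_div_iff₀ (by positivity)]
  linarith

lemma integrable_sinc_mul_sinc {a b : ℝ} (ha : a ≠ 0) (hb : b ≠ 0) :
    Integrable (fun x => sinc (a * x) * sinc (b * x)) := by
  have h : ∀ {c : ℝ}, c ≠ 0 → MemLp (fun x => sinc (c * x)) 2 := fun hc =>
    (memLp_two_iff_integrable_sq (by fun_prop)).mpr (integrable_sinc_sq.comp_mul_left' hc)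
  exact (h ha).integrable_mul (h hb)

lemma integrable_sinc_mul_prod_sinc {ι : Type*} [Fintype ι] [Nonempty ι] {a : ℝ} (ha : a ≠ 0)
    {w : ι → ℝ} (hw : ∀ i, w i ≠ 0) :
    Integrable (fun x => sinc (a * x) * ∏ i, sinc (w i * x)) := by
  classical
  let i₀ : ι := Classical.arbitrary ι
  have h := (integrable_sinc_mul_sinc ha (hw i₀)).mul_bdd (c := 1)
    (g := fun x => ∏ i ∈ univ.erase i₀, sinc (w i * x))
    (by
      refine Continuous.aestronglyMeasurable (continuous_finsetProd _ fun i _ => ?_)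
      exact continuous_sinc.comp (continuous_const.mul continuous_id))
    (ae_of_all _ fun x => by
      rw [norm_prod]
      exact prod_le_one (fun _ _ => norm_nonneg _) fun i _ => abs_sinc_le_one _)
  refine h.congr (ae_of_all _ fun x => ?_)
  simp only [mul_assoc, mul_prod_erase univ (fun i => sinc (w i * x)) (mem_univ i₀)]

lemma volume_setOf_sum_eq {ι : Type*} [Fintype ι] [Nonempty ι] (c : ℝ) :
    volume {x : ι → ℝ | ∑ i, x i = c} = 0 := by
  classical
  let i₀ : ι := Classical.arbitrary ι
  let L : (ι → ℝ) →ₗ[ℝ] ℝ := ∑ i, LinearMap.proj i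
  have hL : ∀ x, L x = ∑ i, x i := fun x => by simp [L]
  let s : AffineSubspace ℝ (ι → ℝ) := (AffineSubspace.mk' c ⊥).comap L.toAffineMap
  have hs : (s : Set (ι → ℝ)) = {x | ∑ i, x i = c} := by
    ext x
    simp [s, AffineSubspace.mem_mk', hL, sub_eq_zero]
  rw [← hs]
  refine Measure.addHaar_affineSubspace volume s fun h => ?_
  have : (Pi.single i₀ (c + 1) : ι → ℝ) ∈ (s : Set (ι → ℝ)) := by rw [h]; trivial
  rw [hs] at this
  simp at this

section Slab

variable {ι : Type*} [Fintype ι]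

/-- The kernel whose integral over `x` is the volume of the section at height `u`. -/
noncomputable def slabKernel (w : ι → ℝ) (θ u : ℝ) (x : ι → ℝ) : ℂ :=
  symmIndicator θ (u - ∑ i, x i) * ∏ i, symmIndicator (w i) (x i)

/-- The volume of `{x | (∀ i, |x i| ≤ w i) ∧ |u - ∑ i, x i| ≤ θ}`, as a complex number. -/
noncomputable def slabVolume (w : ι → ℝ) (θ u : ℝ) : ℂ := ∫ x, slabKernel w θ u x

lemma integrable_prod_symmIndicator (w : ι → ℝ) :
    Integrable (fun x : ι → ℝ => ∏ i, symmIndicator (w i) (x i)) :=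
  Integrable.fintype_prod (μ := fun _ => volume) fun i => integrable_symmIndicator (w i)

lemma measurable_uncurry_slabKernel (w : ι → ℝ) (θ : ℝ) :
    Measurable (Function.uncurry (slabKernel w θ)) := by
  refine ((measurable_symmIndicator θ).comp (by fun_prop)).mul
    (Finset.measurable_fun_prod _ fun i _ => (measurable_symmIndicator (w i)).comp (by fun_prop))

lemma slabKernel_eq_zero_of_lt_sum (w : ι → ℝ) {θ u : ℝ} {x : ι → ℝ} (h : θ < |u - ∑ i, x i|) :
    slabKernel w θ u x = 0 := by
  rw [slabKernel, symmIndicator_of_lt_abs h, zero_mul]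

lemma slabKernel_eq_zero_of_lt_coord {w : ι → ℝ} (θ u : ℝ) {x : ι → ℝ} {i : ι}
    (h : w i < |x i|) : slabKernel w θ u x = 0 := by
  rw [slabKernel, prod_eq_zero (mem_univ i) (symmIndicator_of_lt_abs h), mul_zero]

lemma norm_slabKernel_le (w : ι → ℝ) (θ u : ℝ) (x : ι → ℝ) :
    ‖slabKernel w θ u x‖ ≤ ‖∏ i, symmIndicator (w i) (x i)‖ := by
  rw [slabKernel, norm_mul]
  exact mul_le_of_le_one_left (norm_nonneg _) (norm_symmIndicator_le_one _ _)

lemma integrable_uncurry_slabKernel (w : ι → ℝ) (θ : ℝ) :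
    Integrable (Function.uncurry (slabKernel w θ)) (volume.prod volume) := by
  refine ((integrable_symmIndicator (θ + ∑ i, w i)).mul_prod
    (integrable_prod_symmIndicator w)).mono
    (measurable_uncurry_slabKernel w θ).aestronglyMeasurable (ae_of_all _ fun ⟨u, x⟩ => ?_)
  rw [Function.uncurry_apply_pair]
  by_cases hx : ∀ i, |x i| ≤ w i
  · by_cases hu : |u - ∑ i, x i| ≤ θ
    · have : |u| ≤ θ + ∑ i, w i := calc
        |u| = |(u - ∑ i, x i) + ∑ i, x i| := by ring_nf
        _ ≤ |u - ∑ i, x i| + |∑ i, x i| := abs_add_le _ _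
        _ ≤ θ + ∑ i, w i :=
          add_le_add hu ((abs_sum_le_sum_abs _ _).trans (sum_le_sum fun i _ => hx i))
      simpa [symmIndicator_of_abs_le this] using norm_slabKernel_le w θ u x
    · rw [slabKernel_eq_zero_of_lt_sum w (not_le.mp hu), norm_zero]
      exact norm_nonneg _
  · push Not at hx
    obtain ⟨i, hi⟩ := hx
    rw [slabKernel_eq_zero_of_lt_coord θ u hi, norm_zero]
    exact norm_nonneg _

lemma integrable_slabVolume (w : ι → ℝ) (θ : ℝ) : Integrable (slabVolume w θ) :=
  (integrable_uncurry_slabKernel w θ).integral_prod_left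

lemma slabVolume_zero (w : ι → ℝ) (θ : ℝ) :
    slabVolume w θ 0 =
      ((volume {x : ι → ℝ | (∀ i, |x i| ≤ w i) ∧ |∑ i, x i| ≤ θ}).toReal : ℂ) := by
  set S := {x : ι → ℝ | (∀ i, |x i| ≤ w i) ∧ |∑ i, x i| ≤ θ} with hS
  have hmeas : MeasurableSet S := by
    rw [hS]
    measurability
  have h : slabKernel w θ 0 = S.indicator 1 := by
    ext x
    by_cases hx : x ∈ S
    · rw [Set.indicator_of_mem hx, slabKernel, symmIndicator_of_abs_le (by simpa using hx.2),
        prod_eq_one fun i _ => symmIndicator_of_abs_le (hx.1 i)]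
      simp
    · rw [Set.indicator_of_notMem hx]
      by_cases hx' : ∀ i, |x i| ≤ w i
      · have : θ < |0 - ∑ i, x i| := by
          simpa using not_le.mp fun h => hx ⟨hx', h⟩
        exact slabKernel_eq_zero_of_lt_sum w this
      · push Not at hx'
        obtain ⟨i, hi⟩ := hx'
        exact slabKernel_eq_zero_of_lt_coord θ 0 hi
  rw [slabVolume, h, integral_indicator hmeas]
  simp [Measure.real]

lemma continuousAt_slabVolume [Nonempty ι] (w : ι → ℝ) (θ u : ℝ) :
    ContinuousAt (slabVolume w θ) u := by
  refine continuousAt_of_dominated (bound := fun x => ‖∏ i, symmIndicator (w i) (x i)‖)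
    (.of_forall fun v =>
      ((measurable_uncurry_slabKernel w θ).comp measurable_prodMk_left).aestronglyMeasurable)
    (.of_forall fun v => ae_of_all _ fun x => norm_slabKernel_le w θ v x)
    (integrable_prod_symmIndicator w).norm ?_
  have h₁ := measure_eq_zero_iff_ae_notMem.mp (volume_setOf_sum_eq (ι := ι) (u - θ))
  have h₂ := measure_eq_zero_iff_ae_notMem.mp (volume_setOf_sum_eq (ι := ι) (u + θ))
  filter_upwards [h₁, h₂] with x hx₁ hx₂
  replace hx₁ : ∑ i, x i ≠ u - θ := hx₁
  replace hx₂ : ∑ i, x i ≠ u + θ := hx₂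
  have : |u - ∑ i, x i| ≠ θ := fun h => by
    rcases abs_choice (u - ∑ i, x i) with h' | h' <;> rw [h'] at h
    · exact hx₁ (by linarith)
    · exact hx₂ (by linarith)
  exact (ContinuousAt.comp (f := fun v => v - ∑ i, x i) (continuousAt_symmIndicator this)
    (by fun_prop)).mul continuousAt_const

open FourierTransform in
lemma fourier_slabVolume {w : ι → ℝ} (hw : ∀ i, 0 < w i) {θ : ℝ} (hθ : 0 < θ) (t : ℝ) :
    𝓕 (slabVolume w θ) t =
      ((2 * θ * sinc (2 * π * θ * t) * ∏ i, (2 * w i * sinc (2 * π * w i * t)) : ℝ) : ℂ) := by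
  let e : ℝ → ℂ := fun u => Complex.exp (↑(-2 * π * u * t) * Complex.I)
  have he : Continuous e := by fun_prop
  have e_add : ∀ u v, e (u + v) = e u * e v := fun u v => by
    simp only [e, ← Complex.exp_add]; congr 1; push_cast; ring
  have e_sum : ∀ x : ι → ℝ, e (∑ i, x i) = ∏ i, e (x i) := fun x => by
    simp only [e, ← Complex.exp_sum]; congr 1; push_cast
    rw [mul_sum, sum_mul, sum_mul]
  have hint : Integrable (Function.uncurry fun u x => e u * slabKernel w θ u x)
      (volume.prod volume) := by
    refine (integrable_uncurry_slabKernel w θ).bdd_mul (c := 1) (f := fun p : ℝ × (ι → ℝ) => e p.1)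
      (he.comp continuous_fst).aestronglyMeasurable (ae_of_all _ fun p => ?_)
    simp only [e, Complex.norm_exp_ofReal_mul_I, le_refl]
  have hinner : ∀ x : ι → ℝ, ∫ u, e u * slabKernel w θ u x =
      ((2 * θ * sinc (2 * π * θ * t) : ℝ) : ℂ) * ∏ i, (e (x i) * symmIndicator (w i) (x i)) := by
    intro x
    rw [← integral_add_right_eq_self _ (∑ i, x i), ← integral_exp_mul_symmIndicator hθ,
      ← integral_mul_const]
    refine integral_congr_ae (ae_of_all _ fun u => ?_)
    simp only [slabKernel, add_sub_cancel_right, e_add, e_sum, prod_mul_distrib]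
    simp only [e]
    ring
  calc 𝓕 (slabVolume w θ) t = ∫ u, ∫ x, e u * slabKernel w θ u x := by
        simp only [fourier_real_eq_integral_exp_smul, slabVolume, smul_eq_mul, integral_const_mul, e]
    _ = ∫ x, ∫ u, e u * slabKernel w θ u x := integral_integral_swap hint
    _ = _ := by
        simp only [hinner, integral_const_mul]
        rw [integral_fintype_prod_volume_eq_prod (fun i y => e y * symmIndicator (w i) y)]
        simp only [e, integral_exp_mul_symmIndicator (hw _)]
        push_cast
        rfl

end Slab

/-- Pólya's integral formula for the volume of the polytope `P_{w,θ}^n` given by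
`|xᵢ| ≤ wᵢ` and `|∑ xᵢ| ≤ θ`:
`vol_n(P_{w,θ}^n) = (2^{n+1}/π) ∫₀^∞ (sin θx / x) ∏ᵢ (sin wᵢx / x) dx`. -/
theorem volume_polya_polytope_eq_integral
    (n : ℕ) (hn : 0 < n) (w : Fin n → ℝ) (hw : ∀ i, 0 < w i) (θ : ℝ) (hθ : 0 < θ) :
    (volume {x : Fin n → ℝ | (∀ i, |x i| ≤ w i) ∧ |∑ i, x i| ≤ θ}).toReal =
      ((2 : ℝ) ^ (n + 1) / π) * ∫ x in Set.Ioi (0 : ℝ),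
        (Real.sin (θ * x) / x) * ∏ i, Real.sin (w i * x) / x := by
  have : Nonempty (Fin n) := ⟨⟨0, hn⟩⟩
  set G : ℝ → ℝ := fun x => 2 * θ * sinc (θ * x) * ∏ i, (2 * w i * sinc (w i * x)) with hG
  have hGint : Integrable G := by
    refine ((integrable_sinc_mul_prod_sinc hθ.ne' fun i => (hw i).ne').const_mul
      (2 * θ * ∏ i, (2 * w i))).congr (ae_of_all _ fun x => ?_)
    simp only [hG, prod_mul_distrib]
    ring
  have hF : FourierTransform.fourier (slabVolume w θ) = fun t => ((G (2 * π * t) : ℝ) : ℂ) := by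
    ext t
    rw [fourier_slabVolume hw hθ]
    simp only [hG]
    ring_nf
  have hFint : Integrable (FourierTransform.fourier (slabVolume w θ)) := by
    rw [hF]
    exact (hGint.comp_mul_left' (by positivity)).ofReal
  have hinv := (integrable_slabVolume w θ).fourierInv_fourier_eq hFint
    (continuousAt_slabVolume w θ 0)
  rw [slabVolume_zero, Real.fourierInv_eq', hF] at hinv
  simp only [inner_zero_right, mul_zero, Complex.ofReal_zero, zero_mul, Complex.exp_zero,
    one_smul] at hinv
  rw [integral_complex_ofReal, Complex.ofReal_inj] at hinv
  have habs : ∀ x, G |x| = G x := fun x => by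
    rcases abs_choice x with h | h <;> simp only [hG, h, mul_neg, sinc_neg]
  have hhalf : ∫ x, G x = 2 * ∫ x in Set.Ioi (0 : ℝ), G x := by
    rw [← integral_comp_abs]
    simp only [habs]
  have hpos : ∫ x in Set.Ioi (0 : ℝ), G x = 2 ^ (n + 1) * ∫ x in Set.Ioi (0 : ℝ),
      (Real.sin (θ * x) / x) * ∏ i, Real.sin (w i * x) / x := by
    rw [← integral_const_mul]
    refine setIntegral_congr_fun measurableSet_Ioi fun x (hx : 0 < x) => ?_
    have key : ∀ {a : ℝ}, 0 < a → 2 * a * sinc (a * x) = 2 * (Real.sin (a * x) / x) := by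
      intro a ha
      rw [sinc_of_ne_zero (by positivity)]
      field_simp
    simp only [hG, key hθ, fun i => key (hw i)]
    simp only [prod_mul_distrib, prod_const, card_univ, Fintype.card_fin]
    ring
  rw [← hinv, Measure.integral_comp_mul_left, hhalf, hpos, smul_eq_mul,
    abs_of_pos (by positivity)]
  field_simp
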